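/- arXiv:1504.02716 — 2 statements merged into one kernel-verified Lean document; each statement's English description precedes it below -/
import Mathlib

section
/- In any derivation of the B-edNCE part G of a B-ESG grammar B = (G,T), expanding a non-terminal of a sentential form cannot create a new edge between an already established wire-vertex and a newly created wire-vertex, and cannot increase the in-degree or out-degree of any already established wire-vertex. -/
set_option linter.dupNamespace false

namespace BESG

/-- Vertex labels: terminal node-vertex labels `NL`, terminal wire-vertex labels `WL`,
or non-terminal labels `NT`. -/
abbrev VLab (NL WL NT : Type) := (NL ⊕ WL) ⊕ NT

def isNodeL {NL WL NT : Type} : VLab NL WL NT → Bool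
  | .inl (.inl _) => true
  | _ => false

def isWireL {NL WL NT : Type} : VLab NL WL NT → Bool
  | .inl (.inr _) => true
  | _ => false

def isNTL {NL WL NT : Type} : VLab NL WL NT → Bool
  | .inr _ => true
  | _ => false

/-- A finite directed labelled graph with vertices drawn from `ℕ`, no self-loops,
and parallel edges allowed only with distinct edge labels. -/
structure Graph (VL Ga : Type) where
  verts : Finset ℕ
  edges : Finset (ℕ × Ga × ℕ)
  lab : ℕ → VL
  edge_src : ∀ e ∈ edges, e.1 ∈ verts
  edge_tgt : ∀ e ∈ edges, e.2.2 ∈ verts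
  no_loop : ∀ e ∈ edges, e.1 ≠ e.2.2

variable {NL WL NT EL : Type}

/-- Graphs over the label alphabet of a string-graph grammar. -/
abbrev SG (NL WL NT EL : Type) := Graph (VLab NL WL NT) EL

def inDeg (H : SG NL WL NT EL) (v : ℕ) : ℕ := (H.edges.filter fun e => e.2.2 = v).card

def outDeg (H : SG NL WL NT EL) (v : ℕ) : ℕ := (H.edges.filter fun e => e.1 = v).card

/-- The graph contains no non-terminal vertices. -/
def NoNT (H : SG NL WL NT EL) : Prop := ∀ v ∈ H.verts, ¬ isNTL (H.lab v)

/-- A string graph: no non-terminals, no edges between node-vertices, and every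
wire-vertex has in-degree and out-degree at most one. -/
def IsStringGraph (H : SG NL WL NT EL) : Prop :=
  NoNT H ∧
  (∀ e ∈ H.edges, ¬ (isNodeL (H.lab e.1) ∧ isNodeL (H.lab e.2.2))) ∧
  (∀ v ∈ H.verts, isWireL (H.lab v) → inDeg H v ≤ 1 ∧ outDeg H v ≤ 1)

/-- An encoded string graph: like a string graph, but edges between node-vertices
are allowed exactly when they carry an encoding label from `enc`. -/
def IsEncodedSG (enc : Finset EL) (H : SG NL WL NT EL) : Prop :=
  NoNT H ∧
  (∀ e ∈ H.edges, ((isNodeL (H.lab e.1) ∧ isNodeL (H.lab e.2.2)) ↔ e.2.1 ∈ enc)) ∧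
  (∀ v ∈ H.verts, isWireL (H.lab v) → inDeg H v ≤ 1 ∧ outDeg H v ≤ 1)

/-- Inputs: wire-vertices with no incoming edge. -/
def Inputs (H : SG NL WL NT EL) : Finset ℕ :=
  H.verts.filter fun v => isWireL (H.lab v) = true ∧ inDeg H v = 0

/-- Outputs: wire-vertices with no outgoing edge. -/
def Outputs (H : SG NL WL NT EL) : Finset ℕ :=
  H.verts.filter fun v => isWireL (H.lab v) = true ∧ outDeg H v = 0

def Boundary (H : SG NL WL NT EL) : Finset ℕ := Inputs H ∪ Outputs H

def NTVerts (H : SG NL WL NT EL) : Finset ℕ :=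
  H.verts.filter fun v => isNTL (H.lab v) = true

def wireVertexCount (H : SG NL WL NT EL) : ℕ :=
  (H.verts.filter fun v => isWireL (H.lab v) = true).card

def Adj (H : SG NL WL NT EL) (u w : ℕ) : Prop :=
  ∃ γ, (u, γ, w) ∈ H.edges ∨ (w, γ, u) ∈ H.edges

def ConnectedG (H : SG NL WL NT EL) : Prop :=
  ∀ u ∈ H.verts, ∀ w ∈ H.verts, Relation.ReflTransGen (Adj H) u w

/-- A wire: a maximal connected subgraph consisting of wire-vertices only and
containing at least one edge, given by its (finite) set `s` of vertices. -/
def IsWireSet (H : SG NL WL NT EL) (s : Finset ℕ) : Prop :=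
  s ⊆ H.verts ∧ (∀ v ∈ s, isWireL (H.lab v)) ∧
  (∃ e ∈ H.edges, e.1 ∈ s ∧ e.2.2 ∈ s) ∧
  (∀ u ∈ s, ∀ w ∈ s, Relation.ReflTransGen (fun a b => Adj H a b ∧ a ∈ s ∧ b ∈ s) u w) ∧
  (∀ u ∈ s, ∀ w, isWireL (H.lab w) → w ∈ H.verts → Adj H u w → w ∈ s)

/-- A bare wire: a wire not connected to anything outside itself (in particular to
no node-vertex) and which is a chain rather than a circle. -/
def HasBareWire (D : SG NL WL NT EL) : Prop :=
  ∃ s, IsWireSet D s ∧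
    (∀ e ∈ D.edges, ¬ (e.1 ∈ s ∧ e.2.2 ∉ s) ∧ ¬ (e.2.2 ∈ s ∧ e.1 ∉ s)) ∧
    (∃ v ∈ s, inDeg D v = 0 ∨ outDeg D v = 0)

/-- A connection instruction `(σ, β/γ, x, d)`. -/
structure ConnInstr (NL WL NT EL : Type) where
  src : VLab NL WL NT
  oldLab : EL
  newLab : EL
  target : ℕ
  dirIn : Bool

/-- A production `X → (D, C)` of an edNCE grammar. -/
structure Production (NL WL NT EL : Type) where
  lhs : NT
  body : SG NL WL NT EL
  conn : List (ConnInstr NL WL NT EL)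

/-- An edNCE grammar (with all vertex labels in `NL ⊕ WL` terminal and all edge
labels final, as assumed throughout the paper). -/
structure Grammar (NL WL NT EL : Type) where
  prods : List (Production NL WL NT EL)
  start : NT

/-- The initial graph: a single vertex labelled by the initial non-terminal. -/
def startGraph (S : NT) : SG NL WL NT EL where
  verts := {0}
  edges := ∅
  lab := fun _ => .inr S
  edge_src := by simp
  edge_tgt := by simp
  no_loop := by simp

/-- One derivation step: the non-terminal vertex `v` is replaced by (a fresh copy,
via the injection `f`, of) the body of the `i`-th production, with bridge edges
installed according to the connection instructions. -/
def StepWith (G : Grammar NL WL NT EL) (H : SG NL WL NT EL) (v i : ℕ) (f : ℕ → ℕ)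
    (H' : SG NL WL NT EL) : Prop :=
  ∃ p, G.prods[i]? = some p ∧ v ∈ H.verts ∧ H.lab v = .inr p.lhs ∧
    Set.InjOn f (p.body.verts : Set ℕ) ∧ (∀ w ∈ p.body.verts, f w ∉ H.verts) ∧
    H'.verts = H.verts.erase v ∪ p.body.verts.image f ∧
    (∀ w ∈ H.verts.erase v, H'.lab w = H.lab w) ∧
    (∀ w ∈ p.body.verts, H'.lab (f w) = p.body.lab w) ∧
    (∀ e, e ∈ H'.edges ↔
      (e ∈ H.edges ∧ e.1 ≠ v ∧ e.2.2 ≠ v) ∨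
      (∃ d ∈ p.body.edges, e = (f d.1, d.2.1, f d.2.2)) ∨
      (∃ c ∈ p.conn, c.target ∈ p.body.verts ∧
        ((c.dirIn = true ∧ ∃ w, (w, c.oldLab, v) ∈ H.edges ∧ H.lab w = c.src ∧
            e = (w, c.newLab, f c.target)) ∨
         (c.dirIn = false ∧ ∃ w, (v, c.oldLab, w) ∈ H.edges ∧ H.lab w = c.src ∧
            e = (f c.target, c.newLab, w)))))

/-- A derivation recording its sequence of steps `(v, i, f)`. -/
inductive DerivesSeq (G : Grammar NL WL NT EL) :
    SG NL WL NT EL → List (ℕ × ℕ × (ℕ → ℕ)) → SG NL WL NT EL → Prop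
  | refl (H : SG NL WL NT EL) : DerivesSeq G H [] H
  | step {H K H' : SG NL WL NT EL} {v i : ℕ} {f : ℕ → ℕ} {steps} :
      StepWith G H v i f K → DerivesSeq G K steps H' →
      DerivesSeq G H ((v, i, f) :: steps) H'

def Deriv (G : Grammar NL WL NT EL) (H H' : SG NL WL NT EL) : Prop :=
  ∃ steps, DerivesSeq G H steps H'

/-- A decoding rule: a replacement graph `rhs` with two distinguished glueing
vertices `a` and `b` (the invariant node-vertices of the DPO rule). -/
structure DecRule (NL WL NT EL : Type) where
  rhs : SG NL WL NT EL
  a : ℕ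
  b : ℕ

def NoEncEdges (enc : Finset EL) (H : SG NL WL NT EL) : Prop :=
  ∀ e ∈ H.edges, e.2.1 ∉ enc

/-- A decoding system: one DPO rule per triple `(α, N₁, N₂)` with `α ∈ enc`, whose
RHS is a connected string graph with no inputs, no outputs and no encoding labels,
glued along its two distinguished node-vertices labelled `N₁` and `N₂`. -/
def IsDecodingSystem (enc : Finset EL) (T : EL → NL → NL → DecRule NL WL NT EL) : Prop :=
  ∀ α ∈ enc, ∀ N₁ N₂ : NL,
    IsStringGraph (T α N₁ N₂).rhs ∧ ConnectedG (T α N₁ N₂).rhs ∧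
    (T α N₁ N₂).a ∈ (T α N₁ N₂).rhs.verts ∧ (T α N₁ N₂).b ∈ (T α N₁ N₂).rhs.verts ∧
    (T α N₁ N₂).a ≠ (T α N₁ N₂).b ∧
    (T α N₁ N₂).rhs.lab (T α N₁ N₂).a = .inl (.inl N₁) ∧
    (T α N₁ N₂).rhs.lab (T α N₁ N₂).b = .inl (.inl N₂) ∧
    Inputs (T α N₁ N₂).rhs = ∅ ∧ Outputs (T α N₁ N₂).rhs = ∅ ∧
    NoEncEdges enc (T α N₁ N₂).rhs

/-- One decoding step: an encoding edge `(u, α, w)` between node-vertices is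
replaced (DPO-style) by a fresh copy of the corresponding RHS, glued at `u, w`. -/
def DecStep (enc : Finset EL) (T : EL → NL → NL → DecRule NL WL NT EL)
    (H H' : SG NL WL NT EL) : Prop :=
  ∃ u α w N₁ N₂, ∃ f : ℕ → ℕ,
    (u, α, w) ∈ H.edges ∧ α ∈ enc ∧
    H.lab u = .inl (.inl N₁) ∧ H.lab w = .inl (.inl N₂) ∧
    f (T α N₁ N₂).a = u ∧ f (T α N₁ N₂).b = w ∧
    Set.InjOn f ((T α N₁ N₂).rhs.verts : Set ℕ) ∧
    (∀ x ∈ (T α N₁ N₂).rhs.verts, x ≠ (T α N₁ N₂).a → x ≠ (T α N₁ N₂).b → f x ∉ H.verts) ∧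
    H'.verts = H.verts ∪ (T α N₁ N₂).rhs.verts.image f ∧
    (∀ x ∈ H.verts, H'.lab x = H.lab x) ∧
    (∀ x ∈ (T α N₁ N₂).rhs.verts, H'.lab (f x) = (T α N₁ N₂).rhs.lab x) ∧
    (∀ e, e ∈ H'.edges ↔
      (e ∈ H.edges ∧ e ≠ (u, α, w)) ∨
      ∃ d ∈ (T α N₁ N₂).rhs.edges, e = (f d.1, d.2.1, f d.2.2))

/-- A B-ESG grammar datum: a grammar together with encoding symbols and a
decoding system. -/
structure BESG (NL WL NT EL : Type) where
  G : Grammar NL WL NT EL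
  enc : Finset EL
  T : EL → NL → NL → DecRule NL WL NT EL

/-- The boundary (B-edNCE) conditions and conditions N1, N2, W1–W4 for a single
production, relative to the whole grammar (for W4). -/
def CondsNW (enc : Finset EL) (G : Grammar NL WL NT EL) (p : Production NL WL NT EL) : Prop :=
  -- B-edNCE: no adjacent non-terminals in the body
  (∀ e ∈ p.body.edges, ¬ (isNTL (p.body.lab e.1) ∧ isNTL (p.body.lab e.2.2))) ∧
  -- B-edNCE: no connection instruction with non-terminal source label
  (∀ c ∈ p.conn, ¬ isNTL c.src) ∧
  -- N1: an edge carries an encoding label iff it connects two node-vertices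
  (∀ e ∈ p.body.edges,
    (e.2.1 ∈ enc ↔ (isNodeL (p.body.lab e.1) ∧ isNodeL (p.body.lab e.2.2)))) ∧
  -- N2: instructions targeting a node-vertex from a node label produce encoding labels
  (∀ c ∈ p.conn, isNodeL c.src → c.target ∈ p.body.verts →
    isNodeL (p.body.lab c.target) → c.newLab ∈ enc) ∧
  -- W1: wire-vertices in the body have in- and out-degree at most one
  (∀ v ∈ p.body.verts, isWireL (p.body.lab v) → inDeg p.body v ≤ 1 ∧ outDeg p.body v ≤ 1) ∧
  -- W2: no connection instruction targets a wire-vertex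
  (∀ c ∈ p.conn, c.target ∈ p.body.verts → ¬ isWireL (p.body.lab c.target)) ∧
  -- W3: at most one instruction per wire label, edge label and direction, non-encoding
  (∀ c ∈ p.conn, ∀ c' ∈ p.conn, isWireL c.src → c.src = c'.src →
    c.oldLab = c'.oldLab → c.dirIn = c'.dirIn → c = c') ∧
  (∀ c ∈ p.conn, isWireL c.src → c.newLab ∉ enc) ∧
  -- W4: wires attached (directly or by instruction) to a non-terminal are matched
  -- by an instruction in every production for that non-terminal
  (∀ y ∈ p.body.verts, ∀ Y : NT, p.body.lab y = .inr Y →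
    ∀ (Wl : WL) (β : EL) (d : Bool),
      ((d = true ∧ ∃ x ∈ p.body.verts, p.body.lab x = .inl (.inr Wl) ∧ (x, β, y) ∈ p.body.edges) ∨
       (d = false ∧ ∃ x ∈ p.body.verts, p.body.lab x = .inl (.inr Wl) ∧ (y, β, x) ∈ p.body.edges) ∨
       (∃ c ∈ p.conn, c.src = .inl (.inr Wl) ∧ c.newLab = β ∧ c.target = y ∧ c.dirIn = d)) →
      ∀ p' ∈ G.prods, p'.lhs = Y →
        ∃ c ∈ p'.conn, c.src = .inl (.inr Wl) ∧ c.oldLab = β ∧ c.dirIn = d)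

/-- `B` is a B-ESG grammar. -/
def IsBESG (B : BESG NL WL NT EL) : Prop :=
  IsDecodingSystem B.enc B.T ∧ ∀ p ∈ B.G.prods, CondsNW B.enc B.G p

/-- A concrete derivation `S ⟹* H₁ ⟹*_T F` of the B-ESG grammar `B`. -/
def ConcreteDeriv (B : BESG NL WL NT EL) (F : SG NL WL NT EL) : Prop :=
  ∃ H₁, Deriv B.G (startGraph B.G.start) H₁ ∧ NoNT H₁ ∧
    Relation.ReflTransGen (DecStep B.enc B.T) H₁ F ∧ NoEncEdges B.enc F

/-- The language of a B-ESG grammar. -/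
def Lang (B : BESG NL WL NT EL) : Set (SG NL WL NT EL) := {F | ConcreteDeriv B F}

/-- Graph isomorphism. -/
def Iso (H K : SG NL WL NT EL) : Prop :=
  ∃ φ : ℕ → ℕ, Set.BijOn φ (H.verts : Set ℕ) (K.verts : Set ℕ) ∧
    (∀ v ∈ H.verts, K.lab (φ v) = H.lab v) ∧
    (∀ e ∈ H.edges, (φ e.1, e.2.1, φ e.2.2) ∈ K.edges) ∧
    (∀ e ∈ K.edges, ∃ d ∈ H.edges, e = (φ d.1, d.2.1, φ d.2.2))

/-- Merging two adjacent wire-vertices `u, v` (of the same wire label) into `u`. -/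
def MergeStep (H H' : SG NL WL NT EL) : Prop :=
  ∃ u β v, (u, β, v) ∈ H.edges ∧ u ∈ H.verts ∧ v ∈ H.verts ∧
    isWireL (H.lab u) ∧ isWireL (H.lab v) ∧ H.lab u = H.lab v ∧
    (∀ γ, (v, γ, u) ∉ H.edges) ∧
    H'.verts = H.verts.erase v ∧
    (∀ x ∈ H.verts.erase v, H'.lab x = H.lab x) ∧
    (∀ e, e ∈ H'.edges ↔
      (e ∈ H.edges ∧ e.1 ≠ v ∧ e.2.2 ≠ v) ∨
      (∃ γ x, (v, γ, x) ∈ H.edges ∧ e = (u, γ, x)))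

/-- Wire-homeomorphism: the equivalence closure of merging/splitting. -/
def WireHomeo (H H' : SG NL WL NT EL) : Prop :=
  Relation.EqvGen (MergeStep (NL := NL) (WL := WL) (NT := NT) (EL := EL)) H H'

/-- A matching of `L` into `H`: an injective label-preserving homomorphism such
that the only edges incident to the image of `L` are incident to the image of
the boundary of `L`. -/
def IsMatching (L : SG NL WL NT EL) (m : ℕ → ℕ) (H : SG NL WL NT EL) : Prop :=
  Set.InjOn m (L.verts : Set ℕ) ∧ (∀ v ∈ L.verts, m v ∈ H.verts) ∧
  (∀ v ∈ L.verts, H.lab (m v) = L.lab v) ∧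
  (∀ e ∈ L.edges, (m e.1, e.2.1, m e.2.2) ∈ H.edges) ∧
  (∀ e ∈ H.edges,
    (e.1 ∈ L.verts.image m ∧ e.2.2 ∉ L.verts.image m → e.1 ∈ (Boundary L).image m) ∧
    (e.2.2 ∈ L.verts.image m ∧ e.1 ∉ L.verts.image m → e.2.2 ∈ (Boundary L).image m))

/-- `L` matches onto `H` up to wire-homeomorphism. -/
def MatchesModHomeo (L H : SG NL WL NT EL) : Prop :=
  ∃ Ht m, WireHomeo H Ht ∧ IsMatching L m Ht

/-- A string graph rewrite rule `L ← B → R`, where the common boundary is shared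
by name. -/
def IsSGRule (L R : SG NL WL NT EL) : Prop :=
  IsStringGraph L ∧ IsStringGraph R ∧
  Inputs L = Inputs R ∧ Outputs L = Outputs R ∧
  (∀ v ∈ Boundary L, R.lab v = L.lab v)

/-- Double-pushout rewriting of `G` at the matching `m` of `Lr`, glueing in a
fresh copy (via `g`) of `Rr` along the boundary. -/
def RewriteWith (Lr Rr : SG NL WL NT EL) (G : SG NL WL NT EL) (m g : ℕ → ℕ)
    (G' : SG NL WL NT EL) : Prop :=
  IsMatching Lr m G ∧
  (∀ v ∈ Boundary Lr, g v = m v) ∧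
  Set.InjOn g (Rr.verts : Set ℕ) ∧
  (∀ v ∈ Rr.verts, v ∉ Boundary Lr → g v ∉ G.verts) ∧
  G'.verts = (G.verts \ (Lr.verts \ Boundary Lr).image m) ∪ Rr.verts.image g ∧
  (∀ v ∈ G.verts, v ∉ (Lr.verts \ Boundary Lr).image m → G'.lab v = G.lab v) ∧
  (∀ v ∈ Rr.verts, G'.lab (g v) = Rr.lab v) ∧
  (∀ e, e ∈ G'.edges ↔
    (e ∈ G.edges ∧ (∀ d ∈ Lr.edges, e ≠ (m d.1, d.2.1, m d.2.2)) ∧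
      e.1 ∉ (Lr.verts \ Boundary Lr).image m ∧ e.2.2 ∉ (Lr.verts \ Boundary Lr).image m) ∨
    (∃ d ∈ Rr.edges, e = (g d.1, d.2.1, g d.2.2)))

/-- Rewriting `G` to `G'` with the rule `Lr ← B → Rr` at some matching. -/
def RewriteRel (Lr Rr : SG NL WL NT EL) (G G' : SG NL WL NT EL) : Prop :=
  ∃ m g, RewriteWith Lr Rr G m g G'

/-- Rewriting modulo wire-homeomorphism. -/
def SGRewrite (Lr Rr : SG NL WL NT EL) (G G' : SG NL WL NT EL) : Prop :=
  ∃ Gt, WireHomeo G Gt ∧ RewriteRel Lr Rr Gt G'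

/-- `n`-fold composition of a relation. -/
def RelPow {α : Type*} (r : α → α → Prop) : ℕ → α → α → Prop
  | 0, a, b => a = b
  | n + 1, a, b => ∃ c, r a c ∧ RelPow r n c b

/-- A final subgraph of a production body: a string-graph subgraph not adjacent to
any non-terminal and whose vertices occur in no connection instruction. -/
def IsFinalSub (p : Production NL WL NT EL) (s : Finset ℕ) : Prop :=
  s ⊆ p.body.verts ∧
  (∀ v ∈ s, ¬ isNTL (p.body.lab v)) ∧
  (∀ e ∈ p.body.edges, e.1 ∈ s → e.2.2 ∈ s →
    ¬ (isNodeL (p.body.lab e.1) ∧ isNodeL (p.body.lab e.2.2))) ∧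
  (∀ e ∈ p.body.edges, (e.1 ∈ s → ¬ isNTL (p.body.lab e.2.2)) ∧
    (e.2.2 ∈ s → ¬ isNTL (p.body.lab e.1))) ∧
  (∀ c ∈ p.conn, c.target ∉ s)

/-- A B-ESG transformation step: production `i` of `B` has its body rewritten by
the string graph rewrite rule `Lr ← B → Rr` at a matching into a final subgraph;
everything else is unchanged. -/
def TransformStepAt (B : BESG NL WL NT EL) (Lr Rr : SG NL WL NT EL) (i : ℕ)
    (B' : BESG NL WL NT EL) : Prop :=
  B'.enc = B.enc ∧ B'.T = B.T ∧ B'.G.start = B.G.start ∧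
  ∃ p p', B.G.prods[i]? = some p ∧
    B'.G.prods = B.G.prods.set i p' ∧
    p'.lhs = p.lhs ∧ p'.conn = p.conn ∧
    ∃ s m g, IsFinalSub p s ∧ (∀ v ∈ Lr.verts, m v ∈ s) ∧
      RewriteWith Lr Rr p.body m g p'.body

/-- A B-ESG rewrite pattern `(B₁, B₂)`: same decoding system, same initial
non-terminal, and a production-wise correspondence satisfying NT and IO (with
corresponding non-terminals, inputs and outputs identified by sharing names). -/
def IsRewritePattern (B₁ B₂ : BESG NL WL NT EL) : Prop :=
  IsBESG B₁ ∧ IsBESG B₂ ∧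
  B₁.enc = B₂.enc ∧ B₁.T = B₂.T ∧ B₁.G.start = B₂.G.start ∧
  B₁.G.prods.length = B₂.G.prods.length ∧
  ∀ (i : ℕ) (p₁ p₂ : Production NL WL NT EL),
    B₁.G.prods[i]? = some p₁ → B₂.G.prods[i]? = some p₂ →
    p₁.lhs = p₂.lhs ∧
    NTVerts p₁.body = NTVerts p₂.body ∧
    (∀ v ∈ NTVerts p₁.body, p₁.body.lab v = p₂.body.lab v) ∧
    Inputs p₁.body = Inputs p₂.body ∧ Outputs p₁.body = Outputs p₂.body

/-- A pattern instantiation: identical derivation sequences in `B₁` and `B₂`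
(applying corresponding productions at corresponding non-terminals), followed by
decoding, producing the rule `F ← B → F'`. -/
def Instantiates (B₁ B₂ : BESG NL WL NT EL) (F F' : SG NL WL NT EL) : Prop :=
  ∃ steps H₁ H₁',
    DerivesSeq B₁.G (startGraph B₁.G.start) steps H₁ ∧ NoNT H₁ ∧
    Relation.ReflTransGen (DecStep B₁.enc B₁.T) H₁ F ∧ NoEncEdges B₁.enc F ∧
    DerivesSeq B₂.G (startGraph B₂.G.start) steps H₁' ∧ NoNT H₁' ∧
    Relation.ReflTransGen (DecStep B₂.enc B₂.T) H₁' F' ∧ NoEncEdges B₂.enc F'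

/-- Match-exhaustive B-ESG grammar (Definition: bare-wire productions are
boundedly expandable; no isolated wire-vertices; no empty productions; no
single-non-terminal productions). -/
def MatchExhaustive (B : BESG NL WL NT EL) : Prop :=
  (∀ i p, B.G.prods[i]? = some p → HasBareWire p.body →
    ∃ N, ∀ steps K, DerivesSeq B.G (startGraph B.G.start) steps K →
      steps.countP (fun st => st.2.1 == i) ≤ N) ∧
  (∀ p ∈ B.G.prods, ∀ v ∈ p.body.verts, isWireL (p.body.lab v) →
    0 < inDeg p.body v + outDeg p.body v) ∧
  (∀ p ∈ B.G.prods, p.body.verts.Nonempty) ∧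
  (∀ p ∈ B.G.prods, ¬ ∃ v, p.body.verts = {v} ∧ isNTL (p.body.lab v))

/-- ESG-form: an encoded string graph possibly with extra non-terminals, attached
so that node-node edges are encoding edges, encoding edges avoid wire-vertices,
and wire-vertices keep in-degree and out-degree at most one. -/
def IsESGForm (enc : Finset EL) (H : SG NL WL NT EL) : Prop :=
  (∀ e ∈ H.edges, isNodeL (H.lab e.1) → isNodeL (H.lab e.2.2) → e.2.1 ∈ enc) ∧
  (∀ e ∈ H.edges, e.2.1 ∈ enc → ¬ isWireL (H.lab e.1) ∧ ¬ isWireL (H.lab e.2.2)) ∧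
  (∀ v ∈ H.verts, isWireL (H.lab v) → inDeg H v ≤ 1 ∧ outDeg H v ≤ 1)


/-- In a derivation step, an edge into an established vertex `w` either was already present
or arises from an outgoing connection instruction. -/
theorem StepWith.edge_into_established {p : Production NL WL NT EL} {H : SG NL WL NT EL}
    {f : ℕ → ℕ} {v w : ℕ} {e : ℕ × EL × ℕ} (hw : w ∈ H.verts) (he : e.2.2 = w)
    (hfresh : ∀ x ∈ p.body.verts, f x ∉ H.verts)
    (h : (e ∈ H.edges ∧ e.1 ≠ v ∧ e.2.2 ≠ v) ∨
      (∃ d ∈ p.body.edges, e = (f d.1, d.2.1, f d.2.2)) ∨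
      (∃ c ∈ p.conn, c.target ∈ p.body.verts ∧
        ((c.dirIn = true ∧ ∃ w, (w, c.oldLab, v) ∈ H.edges ∧ H.lab w = c.src ∧
            e = (w, c.newLab, f c.target)) ∨
         (c.dirIn = false ∧ ∃ w, (v, c.oldLab, w) ∈ H.edges ∧ H.lab w = c.src ∧
            e = (f c.target, c.newLab, w))))) :
    (e ∈ H.edges ∧ e.1 ≠ v) ∨
      ∃ c ∈ p.conn, c.dirIn = false ∧ c.src = H.lab w ∧ (v, c.oldLab, w) ∈ H.edges ∧
        e = (f c.target, c.newLab, w) := by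
  subst he
  rcases h with ⟨h, h1, -⟩ | ⟨d, hd, rfl⟩ | ⟨c, hc, ht, ⟨-, x, -, -, rfl⟩ | ⟨hdir, x, hx, hl, rfl⟩⟩
  · exact .inl ⟨h, h1⟩
  · exact absurd hw (hfresh _ (p.body.edge_tgt d hd))
  · exact absurd hw (hfresh _ ht)
  · exact .inr ⟨c, hc, hdir, hl.symm, hx, rfl⟩

/-- In a derivation step, an edge out of an established vertex `w` either was already present
or arises from an incoming connection instruction. -/
theorem StepWith.edge_out_of_established {p : Production NL WL NT EL} {H : SG NL WL NT EL}
    {f : ℕ → ℕ} {v w : ℕ} {e : ℕ × EL × ℕ} (hw : w ∈ H.verts) (he : e.1 = w)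
    (hfresh : ∀ x ∈ p.body.verts, f x ∉ H.verts)
    (h : (e ∈ H.edges ∧ e.1 ≠ v ∧ e.2.2 ≠ v) ∨
      (∃ d ∈ p.body.edges, e = (f d.1, d.2.1, f d.2.2)) ∨
      (∃ c ∈ p.conn, c.target ∈ p.body.verts ∧
        ((c.dirIn = true ∧ ∃ w, (w, c.oldLab, v) ∈ H.edges ∧ H.lab w = c.src ∧
            e = (w, c.newLab, f c.target)) ∨
         (c.dirIn = false ∧ ∃ w, (v, c.oldLab, w) ∈ H.edges ∧ H.lab w = c.src ∧
            e = (f c.target, c.newLab, w))))) :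
    (e ∈ H.edges ∧ e.2.2 ≠ v) ∨
      ∃ c ∈ p.conn, c.dirIn = true ∧ c.src = H.lab w ∧ (w, c.oldLab, v) ∈ H.edges ∧
        e = (w, c.newLab, f c.target) := by
  subst he
  rcases h with ⟨h, -, h1⟩ | ⟨d, hd, rfl⟩ | ⟨c, hc, ht, ⟨hdir, x, hx, hl, rfl⟩ | ⟨-, x, -, -, rfl⟩⟩
  · exact .inl ⟨h, h1⟩
  · exact absurd hw (hfresh _ (p.body.edge_src d hd))
  · exact .inr ⟨c, hc, hdir, hl.symm, hx, rfl⟩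
  · exact absurd hw (hfresh _ ht)

/-- in any derivation of the B-edNCE part of a B-ESG grammar,
expanding a non-terminal of a sentential form creates no new edge between an
already established wire-vertex and a newly created wire-vertex, and does not
increase the in-degree or out-degree of any already established wire-vertex. -/
theorem besg_step_preserves_wire_degrees
    {NL WL NT EL : Type}
    (B : BESG NL WL NT EL) (hB : IsBESG B)
    (H : SG NL WL NT EL) (hsent : Deriv B.G (startGraph B.G.start) H)
    (v i : ℕ) (f : ℕ → ℕ) (H' : SG NL WL NT EL)
    (hstep : StepWith B.G H v i f H') :
    (∀ e ∈ H'.edges,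
      ¬ (e.1 ∈ H.verts ∧ isWireL (H'.lab e.1) ∧
          e.2.2 ∉ H.verts ∧ isWireL (H'.lab e.2.2)) ∧
      ¬ (e.2.2 ∈ H.verts ∧ isWireL (H'.lab e.2.2) ∧
          e.1 ∉ H.verts ∧ isWireL (H'.lab e.1))) ∧
    (∀ w ∈ H.verts, w ≠ v → isWireL (H.lab w) →
      inDeg H' w ≤ inDeg H w ∧ outDeg H' w ≤ outDeg H w) := by
  obtain ⟨p, hp, hv, hlab, hinj, hfresh, hverts, holdLab, hnewLab, hedges⟩ := hstep
  obtain ⟨-, -, -, -, -, hW2, hW3, -⟩ := hB.2 p (List.mem_of_getElem? hp)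
  refine ⟨fun e he => ⟨?_, ?_⟩, fun w hw _ hwire => ⟨?_, ?_⟩⟩
  · rintro ⟨h1, -, h2, hw2⟩
    rcases (hedges e).1 he with ⟨h, -⟩ | ⟨d, hd, rfl⟩ |
      ⟨c, hc, ht, ⟨-, x, -, -, rfl⟩ | ⟨-, x, -, -, rfl⟩⟩
    · exact h2 (H.edge_tgt e h)
    · exact hfresh _ (p.body.edge_src d hd) h1
    · exact hW2 c hc ht (hnewLab _ ht ▸ hw2)
    · exact hfresh _ ht h1
  · rintro ⟨h1, -, h2, hw2⟩
    rcases (hedges e).1 he with ⟨h, -⟩ | ⟨d, hd, rfl⟩ |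
      ⟨c, hc, ht, ⟨-, x, -, -, rfl⟩ | ⟨-, x, -, -, rfl⟩⟩
    · exact h2 (H.edge_src e h)
    · exact hfresh _ (p.body.edge_tgt d hd) h1
    · exact hfresh _ ht h1
    · exact hW2 c hc ht (hnewLab _ ht ▸ hw2)
  · refine Finset.card_le_card_of_forall_subsingleton
      (fun e d => (e = d ∧ e.1 ≠ v) ∨ (d.1 = v ∧ ∃ c ∈ p.conn, c.dirIn = false ∧
        c.src = H.lab w ∧ d.2.1 = c.oldLab ∧ e = (f c.target, c.newLab, w))) ?_ ?_
    · intro e he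
      obtain ⟨he, hew⟩ := Finset.mem_filter.1 he
      rcases StepWith.edge_into_established hw hew hfresh ((hedges e).1 he) with
        ⟨h, h1⟩ | ⟨c, hc, hdir, hsrc, h, heq⟩
      · exact ⟨e, Finset.mem_filter.2 ⟨h, hew⟩, .inl ⟨rfl, h1⟩⟩
      · exact ⟨_, Finset.mem_filter.2 ⟨h, rfl⟩, .inr ⟨rfl, c, hc, hdir, hsrc, rfl, heq⟩⟩
    · rintro d - e₁ ⟨-, ⟨rfl, h1⟩ | ⟨h1, c, hc, hdir, hsrc, hold, rfl⟩⟩ e₂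
        ⟨-, ⟨rfl, h2⟩ | ⟨h2, c', hc', hdir', hsrc', hold', rfl⟩⟩
      · rfl
      · exact absurd h2 h1
      · exact absurd h1 h2
      · rw [hW3 c hc c' hc' (hsrc ▸ hwire) (hsrc.trans hsrc'.symm) (hold.symm.trans hold')
          (hdir.trans hdir'.symm)]
  · refine Finset.card_le_card_of_forall_subsingleton
      (fun e d => (e = d ∧ e.2.2 ≠ v) ∨ (d.2.2 = v ∧ ∃ c ∈ p.conn, c.dirIn = true ∧
        c.src = H.lab w ∧ d.2.1 = c.oldLab ∧ e = (w, c.newLab, f c.target))) ?_ ?_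
    · intro e he
      obtain ⟨he, hew⟩ := Finset.mem_filter.1 he
      rcases StepWith.edge_out_of_established hw hew hfresh ((hedges e).1 he) with
        ⟨h, h1⟩ | ⟨c, hc, hdir, hsrc, h, heq⟩
      · exact ⟨e, Finset.mem_filter.2 ⟨h, hew⟩, .inl ⟨rfl, h1⟩⟩
      · exact ⟨_, Finset.mem_filter.2 ⟨h, rfl⟩, .inr ⟨rfl, c, hc, hdir, hsrc, rfl, heq⟩⟩
    · rintro d - e₁ ⟨-, ⟨rfl, h1⟩ | ⟨h1, c, hc, hdir, hsrc, hold, rfl⟩⟩ e₂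
        ⟨-, ⟨rfl, h2⟩ | ⟨h2, c', hc', hdir', hsrc', hold', rfl⟩⟩
      · rfl
      · exact absurd h2 h1
      · exact absurd h1 h2
      · rw [hW3 c hc c' hc' (hsrc ▸ hwire) (hsrc.trans hsrc'.symm) (hold.symm.trans hold')
          (hdir.trans hdir'.symm)]

end BESG
end

section
/- In a B-ESG transformation step on a B-ESG grammar B = (G,T) modifying a production p by rewriting a final subgraph S of its body, every expansion of p during a derivation creates a fresh copy of S that is not adjacent to any previously established vertex and not adjacent to any non-terminal; hence the neighbourhood of this copy remains unchanged in all subsequent sentential forms of the derivation. -/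
set_option linter.dupNamespace false

namespace BESG

variable {NL WL NT EL : Type}

/-- A set of terminal vertices of `H` none of which is adjacent to a non-terminal. -/
def SeparatedFromNT (H : SG NL WL NT EL) (P : Finset ℕ) : Prop :=
  P ⊆ H.verts ∧ (∀ x ∈ P, ¬ isNTL (H.lab x)) ∧
  (∀ e ∈ H.edges, (e.1 ∈ P → ¬ isNTL (H.lab e.2.2)) ∧ (e.2.2 ∈ P → ¬ isNTL (H.lab e.1)))

/-- `K` has the same vertices, labels and incident edges as `H` on `P`. -/
def SameNeighbourhood (H K : SG NL WL NT EL) (P : Finset ℕ) : Prop :=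
  (∀ x ∈ P, x ∈ K.verts ∧ K.lab x = H.lab x) ∧
  (∀ e : ℕ × EL × ℕ, e.1 ∈ P ∨ e.2.2 ∈ P → (e ∈ K.edges ↔ e ∈ H.edges))

theorem SeparatedFromNT.step {G : Grammar NL WL NT EL} {H K : SG NL WL NT EL} {P : Finset ℕ}
    {v i : ℕ} {f : ℕ → ℕ} (hP : SeparatedFromNT H P) (hstep : StepWith G H v i f K) :
    SeparatedFromNT K P ∧ SameNeighbourhood H K P := by
  obtain ⟨hsub, hlab, hadj⟩ := hP
  obtain ⟨p, -, -, hvlab, -, hfresh, hverts, hold, -, hedges⟩ := hstep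
  have hvNT : isNTL (H.lab v) = true := by rw [hvlab]; rfl
  have hne : ∀ x ∈ P, x ≠ v := by
    rintro x hx rfl
    exact hlab x hx hvNT
  have hf : ∀ w ∈ p.body.verts, f w ∉ P := fun w hw h => hfresh w hw (hsub h)
  have hlabP : ∀ x ∈ P, K.lab x = H.lab x := fun x hx =>
    hold x (Finset.mem_erase.2 ⟨hne x hx, hsub hx⟩)
  have hvertsP : P ⊆ K.verts := fun x hx => by
    rw [hverts]
    exact Finset.mem_union_left _ (Finset.mem_erase.2 ⟨hne x hx, hsub hx⟩)
  have hkept : ∀ e : ℕ × EL × ℕ, e.1 ∈ P ∨ e.2.2 ∈ P → e ∈ K.edges →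
      e ∈ H.edges ∧ e.1 ≠ v ∧ e.2.2 ≠ v := by
    intro e he heK
    rcases (hedges e).1 heK with h | ⟨d, hd, rfl⟩ |
      ⟨c, -, hc, ⟨-, w, hw, -, rfl⟩ | ⟨-, w, hw, -, rfl⟩⟩
    · exact h
    · rcases he with he | he
      · exact absurd he (hf _ (p.body.edge_src d hd))
      · exact absurd he (hf _ (p.body.edge_tgt d hd))
    · rcases he with he | he
      · exact absurd hvNT ((hadj _ hw).1 he)
      · exact absurd he (hf _ hc)
    · rcases he with he | he
      · exact absurd he (hf _ hc)
      · exact absurd hvNT ((hadj _ hw).2 he)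
  refine ⟨⟨hvertsP, fun x hx => ?_, fun e he => ⟨fun h => ?_, fun h => ?_⟩⟩,
    fun x hx => ⟨hvertsP hx, hlabP x hx⟩, fun e he => ⟨fun h => (hkept e he h).1, fun h => ?_⟩⟩
  · rw [hlabP x hx]
    exact hlab x hx
  · obtain ⟨heH, -, h2⟩ := hkept e (Or.inl h) he
    rw [hold _ (Finset.mem_erase.2 ⟨h2, H.edge_tgt e heH⟩)]
    exact (hadj e heH).1 h
  · obtain ⟨heH, h1, -⟩ := hkept e (Or.inr h) he
    rw [hold _ (Finset.mem_erase.2 ⟨h1, H.edge_src e heH⟩)]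
    exact (hadj e heH).2 h
  · refine (hedges e).2 (Or.inl ⟨h, ?_, ?_⟩)
    · rcases he with he | he
      · exact hne _ he
      · intro hv
        exact (hadj e h).2 he (hv ▸ hvNT)
    · rcases he with he | he
      · intro hv
        exact (hadj e h).1 he (hv ▸ hvNT)
      · exact hne _ he

theorem SameNeighbourhood.trans {H K L : SG NL WL NT EL} {P : Finset ℕ}
    (h₁ : SameNeighbourhood H K P) (h₂ : SameNeighbourhood K L P) : SameNeighbourhood H L P :=
  ⟨fun x hx => ⟨(h₂.1 x hx).1, (h₂.1 x hx).2.trans (h₁.1 x hx).2⟩,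
    fun e he => (h₂.2 e he).trans (h₁.2 e he)⟩

theorem SeparatedFromNT.sameNeighbourhood_of_derivesSeq {G : Grammar NL WL NT EL}
    {H K : SG NL WL NT EL} {P : Finset ℕ} {steps : List (ℕ × ℕ × (ℕ → ℕ))}
    (hP : SeparatedFromNT H P) (hd : DerivesSeq G H steps K) : SameNeighbourhood H K P := by
  induction hd with
  | refl H => exact ⟨fun x hx => ⟨hP.1 hx, rfl⟩, fun _ _ => Iff.rfl⟩
  | step hstep _ ih => exact (hP.step hstep).2.trans (ih (hP.step hstep).1)

/-- Every edge at the copy of a final subgraph comes from an edge of the production body. -/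
theorem IsFinalSub.exists_body_edge {G : Grammar NL WL NT EL} {p : Production NL WL NT EL}
    {s : Finset ℕ} (hs : IsFinalSub p s) {H H' : SG NL WL NT EL} {v i : ℕ} {f : ℕ → ℕ}
    (hp : G.prods[i]? = some p) (hstep : StepWith G H v i f H') {e : ℕ × EL × ℕ}
    (he : e ∈ H'.edges) (hes : e.1 ∈ s.image f ∨ e.2.2 ∈ s.image f) :
    ∃ d ∈ p.body.edges, e = (f d.1, d.2.1, f d.2.2) := by
  obtain ⟨hsub, -, -, -, hconn⟩ := hs
  obtain ⟨q, hq, -, -, hinj, hfresh, -, -, -, hedges⟩ := hstep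
  obtain rfl : p = q := Option.some.inj (hp.symm.trans hq)
  have hnew : ∀ x ∈ s.image f, x ∉ H.verts := by
    intro x hx
    obtain ⟨a, ha, rfl⟩ := Finset.mem_image.1 hx
    exact hfresh a (hsub ha)
  have htarget : ∀ c ∈ p.conn, c.target ∈ p.body.verts → f c.target ∉ s.image f := by
    intro c hc hcv hx
    obtain ⟨a, ha, hac⟩ := Finset.mem_image.1 hx
    exact hconn c hc (hinj (hsub ha) hcv hac ▸ ha)
  rcases (hedges e).1 he with ⟨h, -, -⟩ | h |
    ⟨c, hc, hcv, ⟨-, w, hw, -, rfl⟩ | ⟨-, w, hw, -, rfl⟩⟩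
  · rcases hes with hes | hes
    · exact absurd (H.edge_src e h) (hnew _ hes)
    · exact absurd (H.edge_tgt e h) (hnew _ hes)
  · exact h
  · rcases hes with hes | hes
    · exact absurd (H.edge_src _ hw) (hnew _ hes)
    · exact absurd hes (htarget c hc hcv)
  · rcases hes with hes | hes
    · exact absurd hes (htarget c hc hcv)
    · exact absurd (H.edge_tgt _ hw) (hnew _ hes)

theorem IsFinalSub.separatedFromNT_image {G : Grammar NL WL NT EL} {p : Production NL WL NT EL}
    {s : Finset ℕ} (hs : IsFinalSub p s) {H H' : SG NL WL NT EL} {v i : ℕ} {f : ℕ → ℕ}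
    (hp : G.prods[i]? = some p) (hstep : StepWith G H v i f H') :
    SeparatedFromNT H' (s.image f) := by
  have hbody := fun e he hes => hs.exists_body_edge hp hstep (e := e) he hes
  obtain ⟨hsub, hterm, -, hadj, -⟩ := hs
  obtain ⟨q, hq, -, -, hinj, -, hverts, -, hlab, -⟩ := hstep
  obtain rfl : p = q := Option.some.inj (hp.symm.trans hq)
  have hmem : ∀ a ∈ p.body.verts, f a ∈ s.image f → a ∈ s := by
    intro a ha hx
    obtain ⟨b, hb, hba⟩ := Finset.mem_image.1 hx
    exact hinj (hsub hb) ha hba ▸ hb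
  refine ⟨?_, fun x hx => ?_, fun e he => ⟨fun h => ?_, fun h => ?_⟩⟩
  · rw [hverts]
    exact (Finset.image_subset_image hsub).trans Finset.subset_union_right
  · obtain ⟨a, ha, rfl⟩ := Finset.mem_image.1 hx
    rw [hlab a (hsub ha)]
    exact hterm a ha
  · obtain ⟨d, hd, rfl⟩ := hbody e he (Or.inl h)
    rw [hlab _ (p.body.edge_tgt d hd)]
    exact (hadj d hd).1 (hmem _ (p.body.edge_src d hd) h)
  · obtain ⟨d, hd, rfl⟩ := hbody e he (Or.inr h)
    rw [hlab _ (p.body.edge_src d hd)]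
    exact (hadj d hd).2 (hmem _ (p.body.edge_tgt d hd) h)

/-- expanding the production `p` (the one modified by a B-ESG
transformation step) creates a fresh copy of its final subgraph `s` which is not
adjacent to any previously established vertex nor to any non-terminal, and whose
neighbourhood remains unchanged in all subsequent sentential forms. -/
theorem besg_final_subgraph_copies_fresh
    {NL WL NT EL : Type}
    (B : BESG NL WL NT EL) (hB : IsBESG B)
    (i : ℕ) (p : Production NL WL NT EL) (hp : B.G.prods[i]? = some p)
    (s : Finset ℕ) (hs : IsFinalSub p s)
    (H : SG NL WL NT EL) (hsent : Deriv B.G (startGraph B.G.start) H)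
    (v : ℕ) (f : ℕ → ℕ) (H' : SG NL WL NT EL)
    (hstep : StepWith B.G H v i f H') :
    (∀ e ∈ H'.edges,
      ¬ (e.1 ∈ s.image f ∧ e.2.2 ∈ H.verts.erase v) ∧
      ¬ (e.2.2 ∈ s.image f ∧ e.1 ∈ H.verts.erase v)) ∧
    (∀ e ∈ H'.edges,
      (e.1 ∈ s.image f → ¬ isNTL (H'.lab e.2.2)) ∧
      (e.2.2 ∈ s.image f → ¬ isNTL (H'.lab e.1))) ∧
    (∀ K : SG NL WL NT EL, Deriv B.G H' K →
      (∀ x ∈ s.image f, x ∈ K.verts ∧ K.lab x = H'.lab x) ∧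
      (∀ e : ℕ × EL × ℕ, e.1 ∈ s.image f ∨ e.2.2 ∈ s.image f →
        (e ∈ K.edges ↔ e ∈ H'.edges))) := by
  have hsep := hs.separatedFromNT_image hp hstep
  have hbody := fun e he hes => hs.exists_body_edge hp hstep (e := e) he hes
  refine ⟨fun e he => ?_, hsep.2.2, fun K ⟨_, hd⟩ => hsep.sameNeighbourhood_of_derivesSeq hd⟩
  obtain ⟨q, hq, -, -, -, hfresh, -⟩ := hstep
  obtain rfl : p = q := Option.some.inj (hp.symm.trans hq)
  constructor
  · rintro ⟨h, hold⟩
    obtain ⟨d, hd, rfl⟩ := hbody e he (Or.inl h)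
    exact hfresh _ (p.body.edge_tgt d hd) (Finset.mem_of_mem_erase hold)
  · rintro ⟨h, hold⟩
    obtain ⟨d, hd, rfl⟩ := hbody e he (Or.inr h)
    exact hfresh _ (p.body.edge_src d hd) (Finset.mem_of_mem_erase hold)

end BESG
end
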